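/- Let X be a locally compact Hausdorff space countable at infinity and let J ⊆ X × P(X) be a lower semicontinuous multifunction. If a function φ on X is locally bounded above, absolutely measurable (i.e. measurable with respect to every regular Borel measure on X), and satisfies μ(φ) ≥ φ(x) for every x ∈ X and every μ ∈ J_x, then its upper semicontinuous regularization φ* also satisfies μ(φ*) ≥ φ*(x) for every x ∈ X and every μ ∈ J_x. -/

import Mathlib

open MeasureTheory Topology Filter Set
open scoped ENNReal Classical

noncomputable section

/-- The non-negative part of an extended real, as an extended non-negative real. -/
def erealToENNReal (x : EReal) : ℝ≥0∞ := if x = ⊤ then ⊤ else ENNReal.ofReal x.toReal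

/-- The integral `μ(φ) ∈ [-∞, ∞]` of an `EReal`-valued function: the (extended) integral of the
positive part minus the (extended) integral of the negative part. -/
def eInt {X : Type*} [MeasurableSpace X] (μ : Measure X) (φ : X → EReal) : EReal :=
  ((∫⁻ y, erealToENNReal (φ y) ∂μ : ℝ≥0∞) : EReal) -
    ((∫⁻ y, erealToENNReal (-(φ y)) ∂μ : ℝ≥0∞) : EReal)

/-- Lower semicontinuity of a multifunction `J ⊆ X × P(X)` with respect to the weak-* topology:
for every `x`, every `μ ∈ J_x`, and every basic weak-* neighborhood of `μ` (given by finitely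
many test functions and `ε > 0`), all points `y` near `x` admit `ν ∈ J_y` in that
neighborhood. -/
def LSCMulti {X : Type*} [TopologicalSpace X] [MeasurableSpace X]
    (J : X → Set (Measure X)) : Prop :=
  ∀ x : X, ∀ μ ∈ J x, ∀ (Φ : Finset C(X, ℝ)) (ε : ℝ), 0 < ε →
    ∃ W ∈ 𝓝 x, ∀ y ∈ W, ∃ ν ∈ J y, ∀ ψ ∈ Φ, |(∫ z, ψ z ∂ν) - ∫ z, ψ z ∂μ| < ε

/-- The upper semicontinuous regularization of a locally bounded above function:
`φ*(x) = inf{sup_{y ∈ U} φ(y) : U open, x ∈ U}`. -/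
def upperReg {X : Type*} [TopologicalSpace X] (φ : X → ℝ) (x : X) : EReal :=
  ⨅ U ∈ {U : Set X | IsOpen U ∧ x ∈ U}, ⨆ y ∈ U, ((φ y : ℝ) : EReal)

theorem inner_approx {X : Type*} [TopologicalSpace X] [T2Space X]
    [LocallyCompactSpace X] [MeasurableSpace X] [BorelSpace X]
    (μ : Measure X) [IsProbabilityMeasure μ] [μ.Regular] {K : Set X} (hK : IsCompact K)
    (hμK : μ Kᶜ = 0) (h : X → NNReal) (hh : LowerSemicontinuous h) (r : ℝ≥0∞)
    (hr : r < ∫⁻ x, (h x : ℝ≥0∞) ∂μ) :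
    ∃ u : C(X, NNReal), (∀ x, u x ≤ h x) ∧ r < ∫⁻ x, (u x : ℝ≥0∞) ∂μ := by
  rw [lintegral_eq_nnreal] at hr
  simp only [lt_iSup_iff] at hr
  obtain ⟨s, hs, hrs⟩ := hr
  rw [← SimpleFunc.lintegral_eq_lintegral] at hrs
  have hsle : ∀ x, s x ≤ h x := fun x => by exact_mod_cast hs x
  have hrs' : r < ∫⁻ x, (s x : ℝ≥0∞) ∂μ := hrs
  obtain ⟨δ, hδ, hrδ⟩ := ENNReal.lt_iff_exists_add_pos_lt.1 hrs'
  have hfin : (∫⁻ x, (s x : ℝ≥0∞) ∂μ) ≠ ∞ := by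
    obtain ⟨C, hC⟩ := (s.finite_range.bddAbove)
    refine ne_of_lt (lt_of_le_of_lt (lintegral_mono (g := fun _ => (C : ℝ≥0∞)) ?_) ?_)
    · intro x
      have := hC (mem_range_self x)
      exact ENNReal.coe_le_coe.2 this
    · simp
  have hδ2 : (0 : NNReal) < δ / 2 := by positivity
  obtain ⟨g, hgs, hgu, hgi⟩ := SimpleFunc.exists_upperSemicontinuous_le_lintegral_le (μ := μ) s hfin
    (ε := ((δ / 2 : NNReal) : ℝ≥0∞)) (by exact_mod_cast hδ2.ne')
  have key : ∃ u : C(X, NNReal), (∀ x, u x ≤ h x) ∧ ∀ z ∈ K, g z < u z + δ / 2 := by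
    refine hK.induction_on (p := fun S => ∃ u : C(X, NNReal), (∀ x, u x ≤ h x) ∧
      ∀ z ∈ S, g z < u z + δ / 2) ?_ ?_ ?_ ?_
    · exact ⟨0, fun x => by simp, by simp⟩
    · rintro S T hST ⟨u, hu, hu'⟩
      exact ⟨u, hu, fun z hz => hu' z (hST hz)⟩
    · rintro S T ⟨u, hu, hu'⟩ ⟨v, hv, hv'⟩
      refine ⟨u ⊔ v, fun x => sup_le (hu x) (hv x), ?_⟩
      rintro z (hz | hz)
      · exact (hu' z hz).trans_le (by gcongr; exact le_sup_left)
      · exact (hv' z hz).trans_le (by gcongr; exact le_sup_right)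
    · intro y _
      obtain ⟨u, hu, huy⟩ : ∃ u : C(X, NNReal), (∀ x, u x ≤ h x) ∧ g y < u y + δ / 2 := by
        rcases eq_or_ne (g y) 0 with h0 | h0
        · exact ⟨0, fun x => by simp, by simpa [h0] using hδ⟩
        · set c : NNReal := g y - δ / 4 with hc
          have hδ4 : (0 : NNReal) < δ / 4 := by positivity
          have hcg : c < g y := tsub_lt_self (pos_iff_ne_zero.2 h0) hδ4
          have hch : c < h y := hcg.trans_le ((hgs y).trans (hsle y))
          have hU : IsOpen (h ⁻¹' Ioi c) := hh.isOpen_preimage c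
          obtain ⟨f, hf0, hf1, hf⟩ := exists_continuous_zero_one_of_isCompact'
            (isCompact_singleton (x := y)) hU.isClosed_compl
            (by simpa using hch)
          refine ⟨⟨fun x => c * Real.toNNReal (f x), by fun_prop⟩, ?_, ?_⟩
          · intro x
            by_cases hx : x ∈ h ⁻¹' Ioi c
            · have h1 : Real.toNNReal (f x) ≤ 1 := by
                rw [Real.toNNReal_le_one]; exact (hf x).2
              have : c * Real.toNNReal (f x) ≤ c := mul_le_of_le_one_right' h1
              exact this.trans (le_of_lt hx)
            · have : f x = 0 := hf0 hx
              simp [this]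
          · have : f y = 1 := hf1 rfl
            simp only [ContinuousMap.coe_mk, this, Real.toNNReal_one, mul_one]
            have h2 : g y ≤ c + δ / 4 := le_tsub_add
            refine h2.trans_lt ?_
            gcongr
            · norm_num
      refine ⟨{z | g z < u z + δ / 2}, mem_nhdsWithin_of_mem_nhds ?_, u, hu, fun z hz => hz⟩
      obtain ⟨t, ht1, ht2⟩ := exists_between huy
      have e1 := hgu y t ht1
      have e2 : ∀ᶠ z in 𝓝 y, t < u z + δ / 2 := by
        have hc : Continuous (fun z => u z + δ / 2) := by fun_prop
        exact hc.continuousAt.eventually (lt_mem_nhds ht2)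
      filter_upwards [e1, e2] with z h1 h2 using h1.trans h2
  obtain ⟨u, hu, hu'⟩ := key
  refine ⟨u, hu, ?_⟩
  have hae : ∀ᵐ z ∂μ, z ∈ K := by
    rw [ae_iff]; exact hμK
  have h1 : ∫⁻ z, (g z : ℝ≥0∞) ∂μ ≤ ∫⁻ z, ((u z : ℝ≥0∞) + ((δ / 2 : NNReal) : ℝ≥0∞)) ∂μ := by
    apply lintegral_mono_ae
    filter_upwards [hae] with z hz
    exact_mod_cast (hu' z hz).le
  rw [lintegral_add_right _ measurable_const] at h1
  simp only [lintegral_const, measure_univ, mul_one] at h1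
  have h2 : r + δ < ∫⁻ z, (u z : ℝ≥0∞) ∂μ + δ := by
    refine hrδ.trans_le (hgi.trans ?_)
    refine (add_le_add_left h1 _).trans ?_
    rw [add_assoc, ← ENNReal.coe_add, add_halves]
  exact lt_of_add_lt_add_right h2

theorem usc_upperReg {X : Type*} [TopologicalSpace X] (φ : X → ℝ) :
    UpperSemicontinuous (upperReg φ) := by
  intro x c hc
  simp only [upperReg, iInf_lt_iff] at hc
  obtain ⟨U, ⟨hU, hx⟩, h⟩ := hc
  filter_upwards [hU.mem_nhds hx] with y hy
  exact lt_of_le_of_lt (iInf₂_le U ⟨hU, hy⟩) h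

theorem le_upperReg {X : Type*} [TopologicalSpace X] (φ : X → ℝ) (x : X) :
    (φ x : EReal) ≤ upperReg φ x :=
  le_iInf₂ fun U hU => le_iSup₂ (f := fun y (_ : y ∈ U) => (φ y : EReal)) x hU.2

theorem upperReg_le_of_eventually {X : Type*} [TopologicalSpace X] (φ : X → ℝ) (x : X) (c : EReal)
    (h : ∀ᶠ y in 𝓝 x, (φ y : EReal) ≤ c) : upperReg φ x ≤ c := by
  obtain ⟨U, hUs, hU, hx⟩ := mem_nhds_iff.1 h
  exact (iInf₂_le U ⟨hU, hx⟩).trans (iSup₂_le fun y hy => hUs hy)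

theorem upperReg_le_cont {X : Type*} [TopologicalSpace X] (φ : X → ℝ) (g : C(X, ℝ))
    (hg : ∀ x, φ x ≤ g x) (x : X) : upperReg φ x ≤ (g x : EReal) := by
  refine le_of_forall_gt_imp_ge_of_dense fun c hc => ?_
  apply upperReg_le_of_eventually
  have : Continuous (fun y => (g y : EReal)) := continuous_coe_real_ereal.comp g.continuous
  filter_upwards [this.continuousAt.eventually (gt_mem_nhds hc)] with y hy
  exact (EReal.coe_le_coe_iff.2 (hg y)).trans hy.le

theorem exists_cont_ge {X : Type*} [TopologicalSpace X] [T2Space X]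
    [LocallyCompactSpace X] [SigmaCompactSpace X] (φ : X → ℝ)
    (hlb : ∀ x : X, ∃ V ∈ 𝓝 x, BddAbove (φ '' V)) : ∃ g : C(X, ℝ), ∀ x, φ x ≤ g x := by
  refine exists_continuous_forall_mem_convex_of_local_const (t := fun x => Ici (φ x))
    (fun x => convex_Ici _) fun x => ?_
  obtain ⟨V, hV, C, hC⟩ := hlb x
  refine ⟨C, ?_⟩
  filter_upwards [hV] with y hy using hC (mem_image_of_mem φ hy)

theorem erealToENNReal_coe (x : ℝ) : erealToENNReal (x : EReal) = ENNReal.ofReal x := by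
  simp [erealToENNReal]

theorem eInt_coe {X : Type*} [MeasurableSpace X] (μ : Measure X) (f : X → ℝ) :
    eInt μ (fun y => (f y : EReal)) =
      ((∫⁻ y, ENNReal.ofReal (f y) ∂μ : ℝ≥0∞) : EReal) -
        ((∫⁻ y, ENNReal.ofReal (-f y) ∂μ : ℝ≥0∞) : EReal) := by
  simp only [eInt, ← EReal.coe_neg, erealToENNReal_coe]

theorem eInt_mono_real {X : Type*} [MeasurableSpace X] (μ : Measure X) (f g : X → ℝ)
    (h : ∀ x, f x ≤ g x) :
    eInt μ (fun y => (f y : EReal)) ≤ eInt μ (fun y => (g y : EReal)) := by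
  rw [eInt_coe, eInt_coe]
  apply EReal.sub_le_sub
  · exact_mod_cast lintegral_mono fun x => ENNReal.ofReal_le_ofReal (h x)
  · exact_mod_cast lintegral_mono fun x => ENNReal.ofReal_le_ofReal (neg_le_neg (h x))

theorem coe_ennreal_eq_toReal {a : ℝ≥0∞} (ha : a ≠ ⊤) : (a : EReal) = ((a.toReal : ℝ) : EReal) := by
  lift a to NNReal using ha
  rfl

theorem eInt_integrable {X : Type*} [MeasurableSpace X] (μ : Measure X) (f : X → ℝ)
    (hf : Integrable f μ) : eInt μ (fun y => (f y : EReal)) = ((∫ y, f y ∂μ : ℝ) : EReal) := by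
  rw [eInt_coe, integral_eq_lintegral_pos_part_sub_lintegral_neg_part hf, EReal.coe_sub,
    ← coe_ennreal_eq_toReal, ← coe_ennreal_eq_toReal]
  · exact hf.neg.lintegral_lt_top.ne
  · exact hf.lintegral_lt_top.ne

theorem integrable_cont {X : Type*} [TopologicalSpace X] [T2Space X]
    [MeasurableSpace X] [BorelSpace X] (μ : Measure X) [IsProbabilityMeasure μ]
    {K : Set X} (hK : IsCompact K) (hμK : μ Kᶜ = 0) (f : C(X, ℝ)) : Integrable f μ := by
  have h := (f.continuous.continuousOn (s := K)).integrableOn_compact (μ := μ) hK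
  rwa [IntegrableOn, Measure.restrict_eq_self_of_ae_mem] at h
  rw [ae_iff]; exact hμK

theorem exists_cont_int_lt {X : Type*} [TopologicalSpace X] [T2Space X]
    [LocallyCompactSpace X] [MeasurableSpace X] [BorelSpace X]
    (μ : Measure X) [IsProbabilityMeasure μ] [μ.Regular] {K : Set X} (hK : IsCompact K)
    (hμK : μ Kᶜ = 0) (F : X → ℝ) (hF : UpperSemicontinuous F) (g : C(X, ℝ))
    (hg : ∀ x, F x ≤ g x) (c : ℝ) (hc : eInt μ (fun y => (F y : EReal)) < c) :
    ∃ ψ : C(X, ℝ), (∀ x, F x ≤ ψ x) ∧ ∫ x, ψ x ∂μ < c := by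
  by_cases hgc : ∫ x, g x ∂μ < c
  · exact ⟨g, hg, hgc⟩
  push Not at hgc
  have hgi := integrable_cont μ hK hμK g
  have hFm : Measurable F := hF.measurable
  have hneg : LowerSemicontinuous (fun x => -F x) := fun x t ht => by
    filter_upwards [hF x (-t) (by linarith)] with z hz
    linarith
  have hlsc := g.continuous.lowerSemicontinuous.add hneg
  have hh : LowerSemicontinuous (fun x => Real.toNNReal (g x + -F x)) := by
    intro x t ht
    have ht' : (t : ℝ) < g x + -F x := by
      exact Real.lt_toNNReal_iff_coe_lt.1 ht
    filter_upwards [hlsc x t ht'] with z hz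
    exact Real.lt_toNNReal_iff_coe_lt.2 hz
  have hH : ENNReal.ofReal (∫ x, g x ∂μ - c) <
      ∫⁻ x, (Real.toNNReal (g x + -F x) : ℝ≥0∞) ∂μ := by
    rw [eInt_coe] at hc
    have ha : ∫⁻ y, ENNReal.ofReal (F y) ∂μ ≠ ⊤ := by
      refine ne_of_lt (lt_of_le_of_lt (lintegral_mono fun y => ENNReal.ofReal_le_ofReal (hg y))
        hgi.lintegral_lt_top)
    have hid : ∫⁻ x, (Real.toNNReal (g x + -F x) : ℝ≥0∞) ∂μ + ∫⁻ y, ENNReal.ofReal (F y) ∂μ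
        + ∫⁻ y, ENNReal.ofReal (-g y) ∂μ =
        ∫⁻ y, ENNReal.ofReal (g y) ∂μ + ∫⁻ y, ENNReal.ofReal (-F y) ∂μ := by
      have gm : Measurable g := g.continuous.measurable
      rw [← lintegral_add_right _ (by fun_prop), ← lintegral_add_right _ (by fun_prop),
        ← lintegral_add_right _ (by fun_prop)]
      congr 1; ext x
      change ENNReal.ofReal _ + _ + _ = _
      have := hg x
      rcases le_total 0 (F x) with h1 | h1 <;> rcases le_total 0 (g x) with h2 | h2
      all_goals
        first
        | rw [ENNReal.ofReal_of_nonpos (p := -F x) (by linarith)]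
        | rw [ENNReal.ofReal_of_nonpos (p := F x) (by linarith)]
        first
        | rw [ENNReal.ofReal_of_nonpos (p := -g x) (by linarith)]
        | rw [ENNReal.ofReal_of_nonpos (p := g x) (by linarith)]
        simp only [add_zero, zero_add]
        try rw [← ENNReal.ofReal_add (by linarith) (by linarith)]
        try rw [← ENNReal.ofReal_add (by linarith) (by linarith)]
        try (congr 1; ring)
      
    by_cases hb : ∫⁻ y, ENNReal.ofReal (-F y) ∂μ = ⊤
    · have : ∫⁻ x, (Real.toNNReal (g x + -F x) : ℝ≥0∞) ∂μ = ⊤ := by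
        rw [hb, add_top] at hid
        have hgn := hgi.neg.lintegral_lt_top.ne
        by_contra hne
        exact (ENNReal.add_ne_top.2 ⟨ENNReal.add_ne_top.2 ⟨hne, ha⟩, hgn⟩) hid
      rw [this]; exact ENNReal.ofReal_lt_top
    · have hFi : Integrable F μ := by
        refine ⟨hFm.aestronglyMeasurable, ?_⟩
        rw [hasFiniteIntegral_iff_norm]
        have : ∀ y, ENNReal.ofReal ‖F y‖ ≤ ENNReal.ofReal (F y) + ENNReal.ofReal (-F y) := by
          intro y
          rw [Real.norm_eq_abs]
          rcases abs_cases (F y) with ⟨h, _⟩ | ⟨h, _⟩ <;> rw [h] <;> simp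
        refine lt_of_le_of_lt (lintegral_mono this) ?_
        rw [lintegral_add_right _ (by fun_prop)]
        exact ENNReal.add_lt_top.2 ⟨lt_top_iff_ne_top.2 ha, lt_top_iff_ne_top.2 hb⟩
      rw [← eInt_coe, eInt_integrable μ F hFi, EReal.coe_lt_coe_iff] at hc
      have : ∫⁻ x, (Real.toNNReal (g x + -F x) : ℝ≥0∞) ∂μ =
          ENNReal.ofReal (∫ x, (g x - F x) ∂μ) := by
        rw [ofReal_integral_eq_lintegral_ofReal (f := fun x => g x - F x) (hgi.sub hFi)
          (Eventually.of_forall fun x => sub_nonneg.2 (hg x))]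
        simp only [← sub_eq_add_neg]; rfl
      rw [this, integral_sub hgi hFi, ENNReal.ofReal_lt_ofReal_iff'] 
      constructor <;> linarith
  obtain ⟨u, hu, hru⟩ := inner_approx μ hK hμK _ hh _ hH
  let v : C(X, ℝ) := ⟨fun x => (u x : ℝ), by fun_prop⟩
  have hvi := integrable_cont μ hK hμK v
  refine ⟨g - v, fun x => ?_, ?_⟩
  · have h1 : (u x : ℝ) ≤ (Real.toNNReal (g x + -F x) : ℝ) := by exact_mod_cast hu x
    rw [Real.coe_toNNReal _ (by linarith [hg x])] at h1
    simp only [ContinuousMap.sub_apply, v, ContinuousMap.coe_mk]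
    linarith
  · have h1 : ∫⁻ x, (u x : ℝ≥0∞) ∂μ = ENNReal.ofReal (∫ x, v x ∂μ) := by
      rw [ofReal_integral_eq_lintegral_ofReal hvi
          (Eventually.of_forall fun x => (u x).2)]
      simp [v]
    rw [h1, ENNReal.ofReal_lt_ofReal_iff'] at hru
    have : ∫ x, (g - v) x ∂μ = ∫ x, g x ∂μ - ∫ x, v x ∂μ := integral_sub hgi hvi
    rw [this]; linarith [hru.1]

/-- Theorem 4.4: let `X` be a locally compact Hausdorff space countable at infinity and
`J ⊆ X × P(X)` a lower semicontinuous multifunction (with fibers consisting of compactly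
supported regular Borel probability measures). If `φ` is locally bounded above, absolutely
measurable, and satisfies `μ(φ) ≥ φ(x)` for all `x ∈ X` and `μ ∈ J_x`, then the upper
regularization `φ*` satisfies `μ(φ*) ≥ φ*(x)` for all `x ∈ X` and `μ ∈ J_x`. -/
theorem upper_regularization_subaveraging {X : Type*} [TopologicalSpace X] [T2Space X]
    [LocallyCompactSpace X] [SigmaCompactSpace X] [MeasurableSpace X] [BorelSpace X]
    (J : X → Set (Measure X))
    (hJfib : ∀ x : X, ∀ μ ∈ J x,
      IsProbabilityMeasure μ ∧ μ.Regular ∧ ∃ K : Set X, IsCompact K ∧ μ Kᶜ = 0)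
    (hJ : LSCMulti J)
    (φ : X → ℝ)
    (hlb : ∀ x : X, ∃ V ∈ 𝓝 x, BddAbove (φ '' V))
    (hmeas : ∀ μ : Measure X, μ.Regular → AEMeasurable φ μ)
    (hsub : ∀ x : X, ∀ μ ∈ J x, ((φ x : ℝ) : EReal) ≤ eInt μ (fun y => ((φ y : ℝ) : EReal))) :
    ∀ x : X, ∀ μ ∈ J x, upperReg φ x ≤ eInt μ (upperReg φ) := by
  intro x μ hμ
  obtain ⟨hP, hR, K, hK, hμK⟩ := hJfib x μ hμ
  obtain ⟨g, hg⟩ := exists_cont_ge φ hlb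
  have hcoe : ∀ y, upperReg φ y = ((upperReg φ y).toReal : EReal) := fun y =>
    (EReal.coe_toReal (ne_top_of_le_ne_top (EReal.coe_ne_top _) (upperReg_le_cont φ g hg y))
      (ne_bot_of_le_ne_bot (EReal.coe_ne_bot _) (le_upperReg φ y))).symm
  set F : X → ℝ := fun y => (upperReg φ y).toReal with hFdef
  have hF : upperReg φ = fun y => (F y : EReal) := funext hcoe
  have husc : UpperSemicontinuous F := by
    intro y c hc
    have h1 : upperReg φ y < (c : EReal) := by
      rw [hcoe y]; exact_mod_cast hc
    filter_upwards [usc_upperReg φ y c h1] with z hz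
    rw [hcoe z] at hz
    exact_mod_cast hz
  have hFg : ∀ y, F y ≤ g y := fun y => by
    have := upperReg_le_cont φ g hg y
    rw [hcoe y] at this
    exact_mod_cast this
  have hφF : ∀ y, φ y ≤ F y := fun y => by
    have := le_upperReg φ y
    rw [hcoe y] at this
    exact_mod_cast this
  refine EReal.le_of_forall_lt_iff_le.1 fun c hc => ?_
  rw [hF] at hc
  obtain ⟨ψ, hψ, hψc⟩ := exists_cont_int_lt μ hK hμK F husc g hFg c hc
  obtain ⟨W, hW, hWν⟩ := hJ x μ hμ {ψ} (c - ∫ z, ψ z ∂μ) (by linarith)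
  apply upperReg_le_of_eventually
  filter_upwards [hW] with y hy
  obtain ⟨ν, hν, hνψ⟩ := hWν y hy
  obtain ⟨hP', hR', K', hK', hνK⟩ := hJfib y ν hν
  have h1 := hνψ ψ (by simp)
  refine (hsub y ν hν).trans ((eInt_mono_real ν φ ψ fun z => (hφF z).trans (hψ z)).trans ?_)
  rw [eInt_integrable ν ψ (integrable_cont ν hK' hνK ψ), EReal.coe_le_coe_iff]
  linarith [(abs_lt.1 h1).2]
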